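/- Let E ⊆ D, F, F̂ be fields inside a Galois extension F̂/E with F̂ = D·F, F/E Galois, and D linearly disjoint from F over E. If S is the integral closure of a subring R of E in F with S = R[z] a ring cover, and V is the integral closure of R in D (a ring cover V = R[w]), then the integral closure Ŝ of R in F̂ equals S·V (the subring generated by S and V). -/

import Mathlib

open Polynomial Pointwise

universe u

/-- A polynomial over a commutative ring is separable as soon as all its images over fields are. -/
theorem Polynomial.separable_of_forall_separable_map {R : Type u} [CommRing R] (p : R[X])
    (h : ∀ (k : Type u) [Field k] (ψ : R →+* k), (p.map ψ).Separable) : p.Separable := by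
  rw [Polynomial.Separable, ← Ideal.isCoprime_span_singleton_iff, Ideal.isCoprime_iff_sup_eq]
  by_contra hne
  obtain ⟨M, hM, hle⟩ := Ideal.exists_le_maximal _ hne
  have hmem : p ∈ M ∧ derivative p ∈ M := by
    simpa [Ideal.span_singleton_le_iff_mem] using hle
  let _ : Field (R[X] ⧸ M) := Ideal.Quotient.field M
  have hroot (f : R[X]) (hf : f ∈ M) :
      (f.map ((Ideal.Quotient.mk M).comp C)).eval (Ideal.Quotient.mk M X) = 0 := by
    rw [eval_map, ← hom_eval₂, eval₂_C_X, Ideal.Quotient.eq_zero_iff_mem]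
    exact hf
  refine (h (R[X] ⧸ M) ((Ideal.Quotient.mk M).comp C)).eval₂_derivative_ne_zero
    (RingHom.id _) (x := Ideal.Quotient.mk M X) ?_ ?_
  · simpa [eval₂_id] using hroot p hmem.1
  · simpa [eval₂_id, derivative_map] using hroot _ hmem.2

section

variable {A K L : Type*} [CommRing A] [IsDomain A] [IsIntegrallyClosed A] [Field K] [Field L]
  [Algebra A K] [IsFractionRing A K] [Algebra K L] [Algebra A L] [IsScalarTower A K L]
  [FiniteDimensional K L] [Algebra.IsSeparable K L]

/-- If `x` is an integral primitive element of `L/K`, then the derivative of its minimal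
polynomial at `x` multiplies all integral elements into `A[x]`. -/
theorem aeval_derivative_minpoly_mul_mem_adjoin {x y : L} (hx : IsIntegral A x)
    (hgen : Algebra.adjoin K {x} = ⊤) (hy : IsIntegral A y) :
    aeval x (derivative (minpoly K x)) * y ∈ Algebra.adjoin A {x} := by
  have hdual : y ∈ (Algebra.traceForm K L).dualSubmodule
      (Subalgebra.toSubmodule (Algebra.adjoin A {x})) := by
    intro t ht
    have ht' : IsIntegral A t := adjoin_le_integralClosure hx ht
    rw [Algebra.traceForm_apply, Submodule.mem_one]
    exact IsIntegrallyClosed.isIntegral_iff.mp (Algebra.isIntegral_trace (hy.mul ht'))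
  rw [traceForm_dualSubmodule_adjoin A K hgen hx] at hdual
  obtain ⟨t, ht, rfl⟩ := hdual
  have hne : aeval x (derivative (minpoly K x)) ≠ 0 :=
    (Algebra.IsSeparable.isSeparable K x).aeval_derivative_ne_zero (minpoly.aeval K x)
  simpa [mul_inv_cancel_left₀ hne] using ht

/-- If a primitive element `x` of `L/K` is a root of a monic separable polynomial over `A`, then
`A[x]` contains all elements of `L` that are integral over `A`. -/
theorem mem_adjoin_of_isIntegral_of_separable {x y : L} {p : A[X]} (hp : p.Monic)
    (hsep : p.Separable) (hpx : aeval x p = 0) (hgen : Algebra.adjoin K {x} = ⊤)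
    (hy : IsIntegral A y) : y ∈ Algebra.adjoin A {x} := by
  have hx : IsIntegral A x := ⟨p, hp, hpx⟩
  have := Module.IsTorsionFree.trans_faithfulSMul A K L
  obtain ⟨h, rfl⟩ := minpoly.isIntegrallyClosed_dvd hx hpx
  obtain ⟨a, b, hab⟩ := hsep
  have hone : aeval x b * aeval x h * aeval x (derivative (minpoly K x)) = 1 := by
    have := congrArg (aeval x) hab
    rw [minpoly.isIntegrallyClosed_eq_field_fractions' K hx, derivative_map,
      aeval_map_algebraMap]
    simp only [derivative_mul, map_add, map_mul, minpoly.aeval, map_one] at this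
    linear_combination this
  have hmem := mul_mem (mul_mem (aeval_mem_adjoin_singleton A x (p := b))
    (aeval_mem_adjoin_singleton A x (p := h)))
    (aeval_derivative_minpoly_mul_mem_adjoin hx hgen hy)
  rwa [← mul_assoc, hone, one_mul] at hmem

end


/-- Compositum of covers: let `F̂/E` be Galois with intermediate fields `D`, `F` such that
`F̂ = D·F`, `F/E` is Galois and `D` is linearly disjoint from `F` over `E`. Let `R` be an
integrally closed domain with quotient field `E`, let `S` be the integral closure of `R` in
`F` with `S = R[z]` a ring cover (unit discriminant expressed by separability of the image
of the minimal polynomial over every field), and `V = R[w]` the integral closure of `R` in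
`D`, likewise a ring cover. Then the integral closure `Ŝ` of `R` in `F̂` equals `S·V`. -/
theorem integralClosure_compositum_of_covers (R E Fhat : Type) [CommRing R] [IsDomain R]
    [IsIntegrallyClosed R] [Field E] [Field Fhat]
    [Algebra R E] [IsFractionRing R E]
    [Algebra E Fhat] [Algebra R Fhat] [IsScalarTower R E Fhat]
    [IsGalois E Fhat]
    (D F : IntermediateField E Fhat) [IsGalois E F]
    (hsup : D ⊔ F = ⊤) (hld : D.LinearDisjoint F)
    -- `S` is the integral closure of `R` in `F`, `V` that of `R` in `D`
    (S V : Subalgebra R Fhat)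
    (hS : S = integralClosure R Fhat ⊓ (F.toSubalgebra.restrictScalars R))
    (hV : V = integralClosure R Fhat ⊓ (D.toSubalgebra.restrictScalars R))
    -- `S = R[z]` is a ring cover
    (z : Fhat) (hzS : Algebra.adjoin R {z} = S)
    (p : Polynomial R) (hp : p.Monic)
    (hpz : p.map (algebraMap R E) = minpoly E z)
    (hpdisc : ∀ (k : Type) [Field k] (ψ : R →+* k), (p.map ψ).Separable)
    -- `V = R[w]` is a ring cover
    (w : Fhat) (hwV : Algebra.adjoin R {w} = V)
    (q : Polynomial R) (hq : q.Monic)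
    (hqw : q.map (algebraMap R E) = minpoly E w)
    (hqdisc : ∀ (k : Type) [Field k] (ψ : R →+* k), (q.map ψ).Separable) :
    integralClosure R Fhat = S ⊔ V := by
  apply le_antisymm
  swap
  · rw [hS, hV]
    exact sup_le inf_le_left inf_le_left
  have hzS' : z ∈ S := hzS ▸ Algebra.self_mem_adjoin_singleton R z
  have hFz : F ≤ IntermediateField.adjoin E {z} := by
    intro f hf
    have halg : IsAlgebraic R f :=
      (IsFractionRing.isAlgebraic_iff R E Fhat).mpr (Algebra.IsAlgebraic.isAlgebraic f)
    obtain ⟨r, hr, hrf⟩ := halg.exists_integral_multiple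
    have hr' : algebraMap R E r ≠ 0 := by simpa using hr
    have hmem : r • f ∈ S := by
      rw [hS]
      refine ⟨hrf, ?_⟩
      rw [← algebraMap_smul E]
      exact F.smul_mem hf
    have hle : S ≤ (IntermediateField.adjoin E {z}).toSubalgebra.restrictScalars R := by
      rw [← hzS]
      exact Algebra.adjoin_le
        (Set.singleton_subset_iff.mpr (IntermediateField.mem_adjoin_simple_self E z))
    have hmem' : r • f ∈ IntermediateField.adjoin E {z} := hle hmem
    rw [← algebraMap_smul E] at hmem'
    have hf' := (IntermediateField.adjoin E {z}).smul_mem hmem' (x := (algebraMap R E r)⁻¹)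
    rwa [smul_smul, inv_mul_cancel₀ hr', one_smul] at hf'
  have htop : IntermediateField.adjoin D {z} = ⊤ := by
    apply IntermediateField.restrictScalars_injective E
    rw [IntermediateField.restrictScalars_top, eq_top_iff, ← hsup, sup_le_iff]
    refine ⟨fun d hd ↦ (IntermediateField.adjoin D {z}).algebraMap_mem ⟨d, hd⟩,
      hFz.trans (IntermediateField.adjoin_le_iff.mpr (Set.singleton_subset_iff.mpr ?_))⟩
    exact IntermediateField.mem_adjoin_simple_self D z
  have : IsScalarTower R D Fhat :=
    .of_algebraMap_eq fun r ↦ by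
      rw [IsScalarTower.algebraMap_apply R E D, ← IsScalarTower.algebraMap_apply E D Fhat,
        ← IsScalarTower.algebraMap_apply R E Fhat]
  have : IsScalarTower R (integralClosure R D) Fhat :=
    .of_algebraMap_eq fun r ↦ IsScalarTower.algebraMap_apply R D Fhat r
  have hzD : IsIntegral D z := Algebra.IsIntegral.isIntegral z
  have hgen : Algebra.adjoin D {z} = ⊤ := by
    rw [← IntermediateField.adjoin_simple_toSubalgebra_of_isAlgebraic hzD.isAlgebraic, htop,
      IntermediateField.top_toSubalgebra]
  have : FiniteDimensional D Fhat := by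
    have := IntermediateField.adjoin.finiteDimensional hzD
    rw [htop] at this
    exact Module.Finite.equiv (IntermediateField.topEquiv (F := D) (E := Fhat)).toLinearEquiv
  have : Algebra.IsAlgebraic R D :=
    (IsFractionRing.comap_isAlgebraic_iff (A := R) (K := E) (C := D)).mpr inferInstance
  have hinj : Function.Injective (algebraMap R D) := by
    rw [IsScalarTower.algebraMap_eq R E D]
    exact (algebraMap E D).injective.comp (IsFractionRing.injective R E)
  have : IsFractionRing (integralClosure R D) D :=
    integralClosure.isFractionRing_of_algebraic
      ((injective_iff_map_eq_zero (algebraMap R D)).mp hinj)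
  have : IsIntegrallyClosed (integralClosure R D) :=
    (IsIntegrallyClosed.integralClosure_eq_bot_iff D).mp integralClosure_idem
  have hpz' : aeval z p = 0 := by
    rw [← aeval_map_algebraMap E, hpz, minpoly.aeval]
  intro y hy
  have hyD : IsIntegral (integralClosure R D) y := IsIntegral.tower_top hy
  have hadj := mem_adjoin_of_isIntegral_of_separable (K := D)
    (hp.map (algebraMap R (integralClosure R D)))
    ((p.separable_of_forall_separable_map hpdisc).map)
    (by rwa [aeval_map_algebraMap]) hgen hyD
  clear hy hyD
  induction hadj using Algebra.adjoin_induction with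
  | mem t ht => exact (le_sup_left : S ≤ S ⊔ V) (Set.mem_singleton_iff.mp ht ▸ hzS')
  | algebraMap v =>
    refine (le_sup_right : V ≤ S ⊔ V) ?_
    rw [hV]
    exact ⟨v.2.map (IsScalarTower.toAlgHom R D Fhat), v.1.2⟩
  | add s t _ _ hs ht => exact add_mem hs ht
  | mul s t _ _ hs ht => exact mul_mem hs ht
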